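/- arXiv:0704.3746 — 7 statements merged into one kernel-verified Lean document; each statement's English description precedes it below -/
import Mathlib

section
/- Let G = (N, E) be a finite simple graph in which every node has at least one neighbor, and let (OC_i)_{i ∈ N} be a family of finite color sets. Then there exists a color assignment on the links of G that is feasible and consistent with (OC_i) if and only if both of the following hold: (i) for every ordered adjacent pair (i,j), OC_i \ OC_j ≠ ∅; and (ii) for every node i, ⋃_{j adjacent to i} (OC_i \ OC_j) = OC_i. -/
/-- Let `G` be a finite simple graph in which every node has at least one
neighbor, and let `OC i` be a family of finite color sets. A color assignment `c` on the
directed links of `G` (giving link `(i,j)` the color set `c i j`) is *feasible* if every link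
gets a nonempty set and, at every node, the colors on outgoing links are disjoint from the
colors on incoming links; it is *consistent* with `OC` if `OC i` is exactly the union of the
color sets on `i`'s outgoing links.  Such a feasible and consistent assignment exists iff
(i) `OC i \ OC j ≠ ∅` for every ordered adjacent pair `(i,j)`, and
(ii) `⋃_{j ~ i} (OC i \ OC j) = OC i` for every node `i`. -/
theorem feasible_consistent_color_assignment_iff
    {V : Type*} [Fintype V] [DecidableEq V]
    (G : SimpleGraph V) [DecidableRel G.Adj]
    (hdeg : ∀ i : V, ∃ j : V, G.Adj i j)
    (OC : V → Finset ℕ) :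
    (∃ c : V → V → Finset ℕ,
      (∀ i j : V, G.Adj i j → (c i j).Nonempty) ∧
      (∀ i : V,
        ((G.neighborFinset i).biUnion (fun j => c i j)) ∩
          ((G.neighborFinset i).biUnion (fun j => c j i)) = ∅) ∧
      (∀ i : V, OC i = (G.neighborFinset i).biUnion (fun j => c i j)))
    ↔
    ((∀ i j : V, G.Adj i j → (OC i \ OC j).Nonempty) ∧
     (∀ i : V, (G.neighborFinset i).biUnion (fun j => OC i \ OC j) = OC i)) := by
  constructor
  · rintro ⟨c, hne, hdisj, hOC⟩
    have mem_sdiff : ∀ i j x, G.Adj i j → x ∈ c i j → x ∈ OC i \ OC j := by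
      intro i j x hij hx
      rw [Finset.mem_sdiff]
      constructor
      · rw [hOC i, Finset.mem_biUnion]
        exact ⟨j, (G.mem_neighborFinset i j).2 hij, hx⟩
      · intro hxj
        rw [hOC j] at hxj
        have hin : x ∈ (G.neighborFinset j).biUnion (fun k => c k j) :=
          Finset.mem_biUnion.2 ⟨i, (G.mem_neighborFinset j i).2 hij.symm, hx⟩
        have hboth := Finset.mem_inter.2 ⟨hxj, hin⟩
        rw [hdisj j] at hboth
        exact Finset.notMem_empty x hboth
    refine ⟨fun i j hij => (hne i j hij).mono fun x => mem_sdiff i j x hij, fun i => ?_⟩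
    refine (Finset.biUnion_subset.2 fun j _ => Finset.sdiff_subset).antisymm fun x hx => ?_
    rw [hOC i] at hx
    obtain ⟨j, hj, hxj⟩ := Finset.mem_biUnion.1 hx
    exact Finset.mem_biUnion.2 ⟨j, hj, mem_sdiff i j x ((G.mem_neighborFinset i j).1 hj) hxj⟩
  · rintro ⟨hne, hunion⟩
    refine ⟨fun i j => OC i \ OC j, hne, fun i => ?_, fun i => (hunion i).symm⟩
    rw [hunion i, ← Finset.disjoint_iff_inter_eq_empty, Finset.disjoint_biUnion_right]
    exact fun j _ => Finset.disjoint_sdiff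
end

section
/- Let B_1, …, B_k be pairwise distinct subsets of a Q-element set, all of the same cardinality g. If g > ⌊Q/2⌋, then there exist pairwise distinct sets C_1, …, C_k such that C_j ⊆ B_j and |C_j| = g − 1 for every j = 1, …, k. -/
open scoped FinsetFamily in
/-- A uniform family above the middle layer is no larger than its shadow. -/
theorem Finset.card_le_card_shadow_of_sized {α : Type*} [DecidableEq α] [Fintype α]
    {𝒜 : Finset (Finset α)} {r : ℕ} (hr : Fintype.card α / 2 < r)
    (h𝒜 : (𝒜 : Set (Finset α)).Sized r) : 𝒜.card ≤ (∂ 𝒜).card := by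
  have hle : Fintype.card α - r + 1 ≤ r := by omega
  refine Nat.le_of_mul_le_mul_right ?_ (Nat.zero_lt_of_lt hr)
  exact (local_lubell_yamamoto_meshalkin_inequality_mul h𝒜).trans (Nat.mul_le_mul_left _ hle)

/-- Let `B 1, …, B k` be pairwise distinct subsets of a `Q`-element set,
all of the same cardinality `g`.  If `g > ⌊Q/2⌋`, then there exist pairwise distinct sets
`C 1, …, C k` with `C j ⊆ B j` and `|C j| = g - 1` for every `j`. -/
theorem exists_distinct_shadow_subsets
    {Q g k : ℕ} (hg : g > Q / 2)
    (B : Fin k → Finset (Fin Q))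
    (hBdist : Function.Injective B)
    (hBcard : ∀ j : Fin k, (B j).card = g) :
    ∃ C : Fin k → Finset (Fin Q),
      Function.Injective C ∧
      (∀ j : Fin k, C j ⊆ B j) ∧
      (∀ j : Fin k, (C j).card = g - 1) := by
  have hall : ∀ s : Finset (Fin k),
      s.card ≤ (s.biUnion fun j => (B j).image (B j).erase).card := by
    intro s
    have hsized : ((s.image B : Finset (Finset (Fin Q))) : Set (Finset (Fin Q))).Sized g := by
      intro A hA
      obtain ⟨j, -, rfl⟩ := Finset.mem_image.mp (Finset.mem_coe.mp hA)
      exact hBcard j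
    have hle := Finset.card_le_card_shadow_of_sized (by simpa using hg) hsized
    rw [Finset.card_image_of_injective s hBdist] at hle
    refine hle.trans (Finset.card_le_card fun A hA => ?_)
    simpa [Finset.mem_shadow_iff] using hA
  obtain ⟨C, hC, hmem⟩ :=
    (Finset.all_card_le_biUnion_card_iff_exists_injective _).mp hall
  refine ⟨C, hC, fun j => ?_, fun j => ?_⟩ <;>
    obtain ⟨a, ha, hCj⟩ := Finset.mem_image.mp (hmem j) <;> rw [← hCj]
  · exact Finset.erase_subset a (B j)
  · rw [Finset.card_erase_of_mem ha, hBcard j]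
end

section
/- Let B_1, …, B_k be pairwise distinct subsets of a Q-element ground set, all of the same cardinality g. If g < ⌊Q/2⌋, then there exist pairwise distinct subsets C_1, …, C_k of the same Q-element ground set such that B_j ⊆ C_j and |C_j| = g + 1 for every j = 1, …, k. -/
open Finset FinsetFamily in
/-- A family of sets of size `r`, with `2 * r + 1 ≤ |α|`, is at most as large as its upper shadow. -/
theorem Finset.card_le_card_upShadow {α : Type*} [Fintype α] [DecidableEq α]
    {𝒜 : Finset (Finset α)} {r : ℕ} (h𝒜 : (𝒜 : Set (Finset α)).Sized r)
    (hr : 2 * r + 1 ≤ Fintype.card α) : #𝒜 ≤ #(∂⁺ 𝒜) := by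
  suffices h : #𝒜 * (r + 1) ≤ #(∂⁺ 𝒜) * (r + 1) from Nat.le_of_mul_le_mul_right h r.succ_pos
  refine card_mul_le_card_mul (· ⊆ ·) (fun s hs => ?_) (fun t ht => ?_)
  · have hs' : r + 1 ≤ #sᶜ := by
      rw [card_compl, h𝒜 hs]
      lia
    refine hs'.trans (card_le_card_of_injOn (insert · s) (fun a ha => ?_) fun a ha b _ hab => ?_)
    · simp only [coe_compl, Set.mem_compl_iff, mem_coe] at ha
      simpa using insert_mem_upShadow hs ha
    · exact (insert_inj (by simpa using ha)).1 hab
  · have htcard : #t = r + 1 := h𝒜.upShadow ht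
    calc #(𝒜.bipartiteBelow (· ⊆ ·) t)
        ≤ #(t.powersetCard r) := card_le_card fun s hs => by
          rw [mem_bipartiteBelow] at hs
          exact mem_powersetCard.2 ⟨hs.2, h𝒜 hs.1⟩
      _ = r + 1 := by simp [htcard]

/-- Let `B 1, …, B k` be pairwise distinct subsets of a `Q`-element ground
set, all of the same cardinality `g`.  If `g < ⌊Q/2⌋`, then there exist pairwise distinct
subsets `C 1, …, C k` of the same ground set with `B j ⊆ C j` and `|C j| = g + 1` for
every `j`. -/
theorem exists_distinct_superset_subsets
    {Q g k : ℕ} (hg : g < Q / 2)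
    (B : Fin k → Finset (Fin Q))
    (hBdist : Function.Injective B)
    (hBcard : ∀ j : Fin k, (B j).card = g) :
    ∃ C : Fin k → Finset (Fin Q),
      Function.Injective C ∧
      (∀ j : Fin k, B j ⊆ C j) ∧
      (∀ j : Fin k, (C j).card = g + 1) := by
  classical
  have hsized (s : Finset (Fin k)) : (s.image B : Set (Finset (Fin Q))).Sized g := by
    intro _ h
    obtain ⟨j, -, rfl⟩ := Finset.mem_image.1 (Finset.mem_coe.1 h)
    exact hBcard j
  obtain ⟨C, hC, hmem⟩ := (Finset.all_card_le_biUnion_card_iff_exists_injective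
      fun j => Finset.upShadow {B j}).1 fun s => by
    have hunion : s.biUnion (fun j => Finset.upShadow {B j}) = (s.image B).upShadow := by
      ext t
      simp [Finset.mem_upShadow_iff]
    rw [hunion, ← Finset.card_image_of_injective s hBdist]
    exact Finset.card_le_card_upShadow (hsized s) (by rw [Fintype.card_fin]; lia)
  refine ⟨C, hC, fun j => ?_, fun j => ?_⟩
  · simpa using Finset.exists_subset_of_mem_upShadow (hmem j)
  · have hj : (({B j} : Finset (Finset (Fin Q))) : Set (Finset (Fin Q))).Sized g := by
      simpa using hsized {j}
    exact hj.upShadow (hmem j)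
end

section
/- Let G = (N, E) be a finite simple graph. Consider the relaxed minimal coloring problem: minimize |⋃_{i ∈ N} B_i| over all families (B_i)_{i ∈ N} of nonempty finite color sets satisfying B_i \ B_j ≠ ∅ and B_j \ B_i ≠ ∅ for every adjacent pair i, j. Then there exists an optimal solution (B_i*)_{i ∈ N} of this problem in which all the sets B_i* have the same cardinality. -/
/-- A family of nonempty finite color sets `B i` is *admissible* for the relaxed minimal
coloring problem if for every adjacent pair `i, j` we have `B i \ B j ≠ ∅` and
`B j \ B i ≠ ∅`. -/
def RelaxedAdmissible {V : Type*} (G : SimpleGraph V) (B : V → Finset ℕ) : Prop :=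
  (∀ i : V, (B i).Nonempty) ∧
  (∀ i j : V, G.Adj i j → (B i \ B j).Nonempty ∧ (B j \ B i).Nonempty)

open scoped FinsetFamily in
/-- In the upper half of the Boolean lattice, a whole layer can be matched injectively into the
layer just below it, each set being sent to one of its subsets. -/
theorem exists_injective_subset_of_layer {α : Type*} [Fintype α] (r : ℕ)
    (hr : Fintype.card α + 1 ≤ 2 * r) :
    ∃ f : {s : Finset α // s.card = r} → Finset α, Function.Injective f ∧
      ∀ s, f s ⊆ s.1 ∧ (f s).card + 1 = r := by
  classical
  obtain ⟨f, hf, hmem⟩ := (Finset.all_card_le_biUnion_card_iff_exists_injective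
    fun s : {s : Finset α // s.card = r} ↦ ∂ {s.1}).1 fun S ↦ by
      have hS : S.biUnion (fun s ↦ ∂ {s.1}) = ∂ (S.map (Function.Embedding.subtype _)) := by
        ext t
        simp [Finset.mem_shadow_iff]
      have hsized : ((S.map (Function.Embedding.subtype _) : Finset (Finset α)) :
          Set (Finset α)).Sized r := by
        intro s hs
        simp only [Finset.coe_map, Set.mem_image] at hs
        obtain ⟨s, -, rfl⟩ := hs
        exact s.2
      have key := Finset.local_lubell_yamamoto_meshalkin_inequality_mul hsized
      rw [hS]
      rw [Finset.card_map] at key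
      exact Nat.le_of_mul_le_mul_right (key.trans (Nat.mul_le_mul_left _ (by omega)))
        (by omega : 0 < r)
  refine ⟨f, hf, fun s ↦ ?_⟩
  obtain ⟨t, ht, hst, hcard⟩ := Finset.mem_shadow_iff_exists_mem_card_add_one.1 (hmem s)
  rw [Finset.mem_singleton] at ht
  subst ht
  exact ⟨hst, by rw [← hcard, s.2]⟩

/-- A family of sets that are incomparable along the edges of a graph can be pushed down to a layer
in the upper half of the Boolean lattice while staying incomparable along the edges. -/
theorem exists_incomparable_card_eq_min {V α : Type*} [Fintype α] (G : SimpleGraph V) (m : ℕ)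
    (hm : Fintype.card α ≤ 2 * m + 1) (A : V → Finset α)
    (hA : ∀ i j, G.Adj i j → ¬ A i ⊆ A j) :
    ∃ A' : V → Finset α, (∀ i j, G.Adj i j → ¬ A' i ⊆ A' j) ∧
      ∀ i, (A' i).card = min (A i).card m := by
  classical
  suffices H : ∀ (d : ℕ) (A : V → Finset α), (∀ i j, G.Adj i j → ¬ A i ⊆ A j) →
      (∀ i, (A i).card ≤ m + d) → ∃ A' : V → Finset α,
        (∀ i j, G.Adj i j → ¬ A' i ⊆ A' j) ∧ ∀ i, (A' i).card = min (A i).card m from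
    H (Fintype.card α) A hA fun i ↦ (Finset.card_le_univ _).trans (by omega)
  intro d
  induction d with
  | zero => exact fun A hA hle ↦ ⟨A, hA, fun i ↦ (min_eq_left (hle i)).symm⟩
  | succ d ih =>
    intro A hA hle
    obtain ⟨f, hf, hfs⟩ := exists_injective_subset_of_layer (α := α) (m + (d + 1)) (by omega)
    let C : V → Finset α := fun i ↦ if h : (A i).card = m + (d + 1) then f ⟨A i, h⟩ else A i
    have hC : ∀ i j, G.Adj i j → ¬ C i ⊆ C j := by
      intro i j hij hsub
      simp only [C] at hsub
      split_ifs at hsub with hi hj hj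
      · have hi' := (hfs ⟨A i, hi⟩).2
        have hj' := (hfs ⟨A j, hj⟩).2
        have heq := hf (Finset.eq_of_subset_of_card_le hsub (by omega))
        exact hA i j hij (congrArg Subtype.val heq).le
      · have hi' := hfs ⟨A i, hi⟩
        have heq := Finset.eq_of_subset_of_card_le hsub (by have := hle j; omega)
        exact hA j i hij.symm (heq ▸ hi'.1)
      · exact hA i j hij (hsub.trans (hfs ⟨A j, hj⟩).1)
      · exact hA i j hij hsub
    have hcard : ∀ i, (C i).card ≤ m + d ∧ min (C i).card m = min (A i).card m := by
      intro i
      have := hle i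
      simp only [C]
      split_ifs with h
      · have := (hfs ⟨A i, h⟩).2
        omega
      · omega
    obtain ⟨A', hA', hc⟩ := ih C hC fun i ↦ (hcard i).1
    exact ⟨A', hA', fun i ↦ (hc i).trans (hcard i).2⟩

/-- A family of sets that are incomparable along the edges of a graph can be replaced by one in
the middle layer of the Boolean lattice. -/
theorem exists_incomparable_card_eq_half {V α : Type*} [Fintype α] (G : SimpleGraph V)
    (A : V → Finset α) (hA : ∀ i j, G.Adj i j → ¬ A i ⊆ A j) :
    ∃ A' : V → Finset α, (∀ i j, G.Adj i j → ¬ A' i ⊆ A' j) ∧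
      ∀ i, (A' i).card = (Fintype.card α + 1) / 2 := by
  classical
  obtain ⟨D, hD, hDc⟩ := exists_incomparable_card_eq_min G ((Fintype.card α + 1) / 2)
    (by omega) A hA
  obtain ⟨F, hF, hFc⟩ := exists_incomparable_card_eq_min G
    (Fintype.card α - (Fintype.card α + 1) / 2) (by omega) (fun i ↦ (D i)ᶜ)
    fun i j hij h ↦ hD j i hij.symm (Finset.compl_subset_compl.1 h)
  refine ⟨fun i ↦ (F i)ᶜ, fun i j hij h ↦ hF j i hij.symm (Finset.compl_subset_compl.1 h),
    fun i ↦ ?_⟩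
  have h1 := hDc i
  have h2 := hFc i
  rw [Finset.card_compl] at h2 ⊢
  omega

theorem relaxedAdmissible_iff {V : Type*} (G : SimpleGraph V) (B : V → Finset ℕ) :
    RelaxedAdmissible G B ↔ (∀ i, (B i).Nonempty) ∧ ∀ i j, G.Adj i j → ¬ B i ⊆ B j := by
  simp only [RelaxedAdmissible, Finset.sdiff_nonempty]
  exact and_congr_right fun _ ↦
    ⟨fun h i j hij ↦ (h i j hij).1, fun h i j hij ↦ ⟨h i j hij, h j i hij.symm⟩⟩

theorem exists_relaxedAdmissible {V : Type*} [Finite V] (G : SimpleGraph V) :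
    ∃ B : V → Finset ℕ, RelaxedAdmissible G B := by
  obtain ⟨n, ⟨e⟩⟩ := Finite.exists_equiv_fin V
  refine ⟨fun i ↦ {(e i : ℕ)}, (relaxedAdmissible_iff G _).2 ⟨by simp, fun i j hij h ↦ ?_⟩⟩
  rw [Finset.singleton_subset_singleton] at h
  exact hij.ne (e.injective (Fin.ext h))

/-- For a finite simple graph `G`, the relaxed minimal coloring problem
(minimize the total number of colors `|⋃ i, B i|` over admissible families) has an optimal
solution in which all the sets `B i` have the same cardinality. -/
theorem exists_equal_cardinality_optimal_solution
    {V : Type*} [Fintype V] (G : SimpleGraph V) :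
    ∃ B : V → Finset ℕ,
      RelaxedAdmissible G B ∧
      (∀ B' : V → Finset ℕ, RelaxedAdmissible G B' →
        (Finset.univ.biUnion B).card ≤ (Finset.univ.biUnion B').card) ∧
      (∀ i j : V, (B i).card = (B j).card) := by
  classical
  obtain ⟨B, hB, hmin⟩ := WellFounded.has_min
    (measure fun B : V → Finset ℕ ↦ (Finset.univ.biUnion B).card).wf
    {B | RelaxedAdmissible G B} (exists_relaxedAdmissible G)
  obtain ⟨hne, hinc⟩ := (relaxedAdmissible_iff G B).1 hB
  set U := Finset.univ.biUnion B
  have hBU : ∀ i, B i ⊆ U := fun i ↦ Finset.subset_biUnion_of_mem B (Finset.mem_univ i)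
  obtain ⟨A, hA, hAc⟩ := exists_incomparable_card_eq_half G
    (fun i ↦ (B i).subtype (· ∈ U)) fun i j hij h ↦ hinc i j hij fun x hx ↦ by
      have := @h ⟨x, hBU i hx⟩ (by simpa using hx)
      simpa using this
  refine ⟨fun i ↦ (A i).map (Function.Embedding.subtype _),
    (relaxedAdmissible_iff G _).2 ⟨fun i ↦ ?_, fun i j hij h ↦ ?_⟩, fun B' hB' ↦ ?_,
    fun i j ↦ by simp only [Finset.card_map, hAc]⟩
  · have hpos : 0 < U.card := Finset.card_pos.2 ((hne i).mono (hBU i))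
    rw [Finset.map_nonempty, ← Finset.card_pos, hAc, Fintype.card_coe]
    omega
  · exact hA i j hij (Finset.map_subset_map.1 h)
  · refine le_trans (Finset.card_le_card ?_) (not_lt.1 (hmin B' hB'))
    exact Finset.biUnion_subset.2 fun i _ ↦ Finset.map_subtype_subset _
end

section
/- Let G = (N, E) be a finite connected simple graph with at least two nodes and chromatic number χ(G). Then there exists a feasible family (OC_i)_{i ∈ N} of finite color sets — that is, one satisfying (i) OC_i \ OC_j ≠ ∅ for every ordered adjacent pair (i,j), and (ii) ⋃_{j adjacent to i} (OC_i \ OC_j) = OC_i for every node i — using at most Q(χ(G)) colors in total: |⋃_{i ∈ N} OC_i| ≤ Q(χ(G)). -/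
/-- `Qmin M` is the least positive integer `q` such that the central binomial
coefficient `C(q, ⌊q/2⌋)` is at least `M`. -/
noncomputable def Qmin (M : ℕ) : ℕ := sInf {q : ℕ | 0 < q ∧ M ≤ q.choose (q / 2)}

theorem Qmin_spec (M : ℕ) : M ≤ (Qmin M).choose (Qmin M / 2) := by
  have hne : {q : ℕ | 0 < q ∧ M ≤ q.choose (q / 2)}.Nonempty :=
    ⟨M + 1, M.succ_pos, by
      have h := Nat.choose_le_middle 1 (M + 1)
      rw [Nat.choose_one_right] at h
      exact (Nat.le_succ M).trans h⟩
  exact (Nat.sInf_mem hne).2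

/-- A graph colorable with at most `q.choose k` colors has an assignment of `k`-subsets of
`range q` to its vertices in which adjacent vertices receive distinct sets. -/
theorem SimpleGraph.Colorable.exists_powersetCard {V : Type*} {G : SimpleGraph V} {n q k : ℕ}
    (hG : G.Colorable n) (h : n ≤ q.choose k) :
    ∃ S : V → Finset ℕ, (∀ i, S i ∈ (Finset.range q).powersetCard k) ∧
      ∀ i j, G.Adj i j → S i ≠ S j := by
  have hcol : G.Colorable (Fintype.card ((Finset.range q).powersetCard k)) :=
    hG.mono (by simpa using h)
  let c := hcol.toColoring le_rfl
  exact ⟨fun i => c i, fun i => (c i).2, fun i j hij e => c.valid hij (Subtype.ext e)⟩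

/-- Let `G` be a finite connected simple graph with at least two nodes and
chromatic number `χ(G)`.  There exists a feasible family `(OC i)` of finite color sets —
i.e. one satisfying (i) `OC i \ OC j ≠ ∅` for every ordered adjacent pair `(i,j)` and
(ii) `⋃_{j ~ i} (OC i \ OC j) = OC i` for every node `i` — using at most `Qmin (χ(G))`
colors in total. -/
theorem exists_feasible_family_card_le_Qmin
    {V : Type*} [Fintype V] [DecidableEq V]
    (G : SimpleGraph V) [DecidableRel G.Adj]
    (hconn : G.Connected) (hcard : 1 < Fintype.card V) :
    ∃ OC : V → Finset ℕ,
      (∀ i j : V, G.Adj i j → (OC i \ OC j).Nonempty) ∧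
      (∀ i : V, (G.neighborFinset i).biUnion (fun j => OC i \ OC j) = OC i) ∧
      (Finset.univ.biUnion OC).card ≤ Qmin G.chromaticNumber.toNat := by
  have hG : G.Colorable G.chromaticNumber.toNat :=
    SimpleGraph.colorable_chromaticNumber G.colorable_of_fintype
  obtain ⟨S, hS, hne⟩ := hG.exists_powersetCard (Qmin_spec _)
  simp only [Finset.mem_powersetCard] at hS
  let T : V → Finset ℕ := fun i => (G.neighborFinset i).biUnion fun j => S i \ S j
  have hTS (i : V) : T i ⊆ S i := Finset.biUnion_subset.2 fun _ _ => Finset.sdiff_subset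
  have hsub {i j : V} (hij : G.Adj i j) : S i \ S j ⊆ T i \ T j := fun x hx =>
    Finset.mem_sdiff.2 ⟨Finset.mem_biUnion.2 ⟨j, by simpa using hij, hx⟩,
      fun hxj => (Finset.mem_sdiff.1 hx).2 (hTS j hxj)⟩
  refine ⟨T, fun i j hij => ?_, fun i => ?_, ?_⟩
  · refine Finset.Nonempty.mono (hsub hij) (Finset.sdiff_nonempty.2 fun hle => ?_)
    exact hne i j hij (Finset.eq_of_subset_of_card_le hle (by rw [(hS i).2, (hS j).2]))
  · refine (Finset.biUnion_subset.2 fun _ _ => Finset.sdiff_subset).antisymm ?_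
    exact Finset.biUnion_mono fun j hj => hsub (by simpa using hj)
  · refine (Finset.card_le_card (Finset.biUnion_subset.2 fun i _ => ?_)).trans_eq
      (Finset.card_range _)
    exact (hTS i).trans (hS i).1
end

section
/- Let G = (N, E) be a finite connected simple graph with at least two nodes and maximum degree Δ(G), and let Q be a positive integer with C(Q, ⌊Q/2⌋) ≥ Δ(G) + 1. Then there exists a family (OC_i)_{i ∈ N} of subsets of a fixed Q-element color set such that: every OC_i has cardinality ⌊Q/2⌋; OC_i ≠ OC_j whenever i and j are adjacent; and (OC_i) is feasible, i.e. (i) OC_i \ OC_j ≠ ∅ for every ordered adjacent pair (i,j) and (ii) ⋃_{j adjacent to i} (OC_i \ OC_j) = OC_i for every node i. Consequently, assigning each link (i,j) the sub-band set Q_{ij} := OC_i \ OC_j gives every link a nonempty set of sub-bands such that no node has a common sub-band on one of its outgoing links and one of its incoming links. -/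
open Finset in
/-- Greedy coloring: any type with more than `Δ(G)` elements admits a proper coloring of `G`. -/
theorem SimpleGraph.exists_proper_coloring_of_maxDegree_lt_card
    {V α : Type*} [Fintype V] [DecidableEq V] [Fintype α]
    (G : SimpleGraph V) [DecidableRel G.Adj] (h : G.maxDegree < Fintype.card α) :
    ∃ f : V → α, ∀ i j, G.Adj i j → f i ≠ f j := by
  classical
  suffices H : ∀ s : Finset V, ∃ f : V → α, ∀ i ∈ s, ∀ j ∈ s, G.Adj i j → f i ≠ f j by
    obtain ⟨f, hf⟩ := H univ
    exact ⟨f, fun i j => hf i (mem_univ i) j (mem_univ j)⟩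
  intro s
  induction s using Finset.induction_on with
  | empty =>
    have : Nonempty α := Fintype.card_pos_iff.1 (by lia)
    exact ⟨fun _ => Classical.arbitrary α, by simp⟩
  | insert v s hv ih =>
    obtain ⟨f, hf⟩ := ih
    obtain ⟨a, ha⟩ : ∃ a, a ∉ (G.neighborFinset v).image f := by
      by_contra! hall
      have h₁ : (univ : Finset α).card ≤ ((G.neighborFinset v).image f).card :=
        card_le_card fun a _ => hall a
      have h₂ := card_image_le (s := G.neighborFinset v) (f := f)
      have h₃ := G.degree_le_maxDegree v
      rw [card_univ] at h₁
      rw [G.card_neighborFinset_eq_degree] at h₂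
      lia
    have ha' : ∀ j, G.Adj v j → f j ≠ a := fun j hj he =>
      ha (mem_image.2 ⟨j, (G.mem_neighborFinset v j).2 hj, he⟩)
    refine ⟨Function.update f v a, fun i hi j hj hij => ?_⟩
    rcases eq_or_ne i v with rfl | hiv
    · rw [Function.update_self, Function.update_of_ne hij.ne']
      exact (ha' j hij).symm
    · rcases eq_or_ne j v with rfl | hjv
      · rw [Function.update_self, Function.update_of_ne hiv]
        exact ha' i hij.symm
      · rw [Function.update_of_ne hiv, Function.update_of_ne hjv]
        exact hf i (mem_of_mem_insert_of_ne hi hiv) j (mem_of_mem_insert_of_ne hj hjv) hij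

/-- If two symmetric arrays agree away from row and column `i` and on the diagonal entry at `i`,
then a strict inequality between their `i`-th row sums passes to the total sums. -/
theorem sum_sum_lt_sum_sum_of_row_lt {V : Type*} [Fintype V] [DecidableEq V]
    {F F' : V → V → ℕ} (hF : ∀ u v, F u v = F v u) (hF' : ∀ u v, F' u v = F' v u) (i : V)
    (hdiag : F' i i = F i i) (hoff : ∀ u v, u ≠ i → v ≠ i → F' u v = F u v)
    (hrow : ∑ v, F' i v < ∑ v, F i v) :
    ∑ u, ∑ v, F' u v < ∑ u, ∑ v, F u v := by
  have key : ∀ A : V → V → ℕ, (∀ u v, A u v = A v u) →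
      ∑ u, ∑ v, A u v + A i i = 2 * ∑ v, A i v +
        ∑ u ∈ Finset.univ.erase i, ∑ v ∈ Finset.univ.erase i, A u v := by
    intro A hA
    have split : ∀ g : V → ℕ, ∑ v, g v = g i + ∑ v ∈ Finset.univ.erase i, g v := fun g =>
      (Finset.add_sum_erase _ g (Finset.mem_univ i)).symm
    rw [split fun u => ∑ v, A u v, Finset.sum_congr rfl fun u _ => split (A u),
      Finset.sum_add_distrib, Finset.sum_congr rfl fun u _ => hA u i, split (A i)]
    ring
  have h := key F hF
  have h' := key F' hF'
  have hrest : ∑ u ∈ Finset.univ.erase i, ∑ v ∈ Finset.univ.erase i, F' u v =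
      ∑ u ∈ Finset.univ.erase i, ∑ v ∈ Finset.univ.erase i, F u v :=
    Finset.sum_congr rfl fun u hu => Finset.sum_congr rfl fun v hv =>
      hoff u v (Finset.ne_of_mem_erase hu) (Finset.ne_of_mem_erase hv)
  lia

open Finset in
/-- Suppose `c ∈ S` belongs to every member of a nonempty family `T` of sets, all with as many
elements as `S` and at most half as many as there are colors. Then some color outside `S` can
replace `c` in `S` so that the total overlap with `T` strictly decreases. -/
theorem exists_exchange_sum_card_inter_lt {V α : Type*} [Fintype α] [DecidableEq α]
    {N : Finset V} (hN : N.Nonempty) {T : V → Finset α} {S : Finset α} {c : α} (hcS : c ∈ S)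
    (hcT : ∀ j ∈ N, c ∈ T j) (hcard : ∀ j ∈ N, (T j).card = S.card)
    (hhalf : 2 * S.card ≤ Fintype.card α) :
    ∃ x ∉ S, ∑ j ∈ N, (insert x (S.erase c) ∩ T j).card < ∑ j ∈ N, (S ∩ T j).card := by
  obtain ⟨j, hj⟩ := hN
  obtain ⟨x, hxS, hxT⟩ : ∃ x ∉ S, x ∉ T j := by
    by_contra! hall
    have hle := card_le_card (s := insert c Sᶜ) (t := T j)
      (insert_subset (hcT j hj) fun x hx => hall x (mem_compl.1 hx))
    rw [card_insert_of_notMem (by simpa using hcS), card_compl, hcard j hj] at hle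
    lia
  have herase : ∀ l ∈ N, (S.erase c ∩ T l).card + 1 = (S ∩ T l).card := fun l hl => by
    rw [erase_inter, card_erase_add_one (mem_inter.2 ⟨hcS, hcT l hl⟩)]
  refine ⟨x, hxS, sum_lt_sum (fun l hl => ?_) ⟨j, hj, ?_⟩⟩
  · rw [← herase l hl]
    exact (card_le_card (by grind)).trans
      (card_insert_le x (S.erase c ∩ T l))
  · rw [← herase j hj, insert_inter_of_notMem hxT]
    exact Nat.lt_succ_self _


/-- Let `G` be a finite connected simple graph with at least two nodes and
maximum degree `Δ(G)`, and let `Q` be a positive integer with `C(Q, ⌊Q/2⌋) ≥ Δ(G) + 1`.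
Then there is a family `(OC i)` of subsets of a fixed `Q`-element color set such that every
`OC i` has cardinality `⌊Q/2⌋`, adjacent nodes get different sets, and `(OC i)` is feasible:
(i) `OC i \ OC j ≠ ∅` for every ordered adjacent pair `(i,j)`, and
(ii) `⋃_{j ~ i} (OC i \ OC j) = OC i` for every node `i`.
Consequently, assigning each link `(i,j)` the sub-band set `OC i \ OC j` gives every link a
nonempty set of sub-bands such that no node has a common sub-band on one of its outgoing
links and one of its incoming links (the duplexing constraint). -/
theorem exists_feasible_subband_allocation
    {V : Type*} [Fintype V] [DecidableEq V]
    (G : SimpleGraph V) [DecidableRel G.Adj]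
    (hconn : G.Connected) (hcard : 1 < Fintype.card V)
    (Q : ℕ) (hQ : 0 < Q) (hchoose : G.maxDegree + 1 ≤ Q.choose (Q / 2)) :
    ∃ OC : V → Finset (Fin Q),
      (∀ i : V, (OC i).card = Q / 2) ∧
      (∀ i j : V, G.Adj i j → OC i ≠ OC j) ∧
      (∀ i j : V, G.Adj i j → (OC i \ OC j).Nonempty) ∧
      (∀ i : V, (G.neighborFinset i).biUnion (fun j => OC i \ OC j) = OC i) ∧
      (∀ i j k : V, G.Adj i j → G.Adj k i →
        (OC i \ OC j) ∩ (OC k \ OC i) = ∅) := by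
  classical
  let P : (V → Finset (Fin Q)) → Prop := fun f =>
    (∀ i, (f i).card = Q / 2) ∧ ∀ i j, G.Adj i j → f i ≠ f j
  have hP : ∃ f, P f := by
    obtain ⟨f, hf⟩ := G.exists_proper_coloring_of_maxDegree_lt_card
      (α := Finset.powersetCard (Q / 2) (Finset.univ : Finset (Fin Q))) (by simpa using hchoose)
    exact ⟨fun i => f i, fun i => (Finset.mem_powersetCard.1 (f i).2).2,
      fun i j hij he => hf i j hij (Subtype.ext he)⟩
  let F : (V → Finset (Fin Q)) → V → V → ℕ := fun f u v =>
    if G.Adj u v then (f u ∩ f v).card else 0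
  have hsymm : ∀ f u v, F f u v = F f v u := fun f u v => by
    simp only [F, G.adj_comm u v, Finset.inter_comm (f u)]
  -- A proper coloring by `Q / 2`-sets that minimizes the total overlap along edges is feasible.
  obtain ⟨f, ⟨hk, hne⟩, hmin⟩ := Set.exists_min_image {f | P f}
    (fun f => ∑ u, ∑ v, F f u v) (Set.toFinite _) hP
  have hnontriv : Nontrivial V := Fintype.one_lt_card_iff_nontrivial.1 hcard
  refine ⟨f, hk, hne, fun i j hij => ?_, fun i => ?_, fun i j k _ _ => by grind⟩
  · rw [Finset.sdiff_nonempty]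
    exact fun hsub => hne i j hij (Finset.eq_of_subset_of_card_le hsub (by rw [hk, hk]))
  · refine (Finset.biUnion_subset.2 fun _ _ => Finset.sdiff_subset).antisymm fun c hc => ?_
    by_contra hcN
    have hcT : ∀ j ∈ G.neighborFinset i, c ∈ f j := fun j hj => by
      by_contra hcj
      exact hcN (Finset.mem_biUnion.2 ⟨j, hj, Finset.mem_sdiff.2 ⟨hc, hcj⟩⟩)
    have hNne : (G.neighborFinset i).Nonempty := by
      rw [← Finset.card_pos, G.card_neighborFinset_eq_degree]
      exact hconn.preconnected.degree_pos_of_nontrivial i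
    obtain ⟨x, hx, hlt⟩ := exists_exchange_sum_card_inter_lt hNne hc hcT
      (fun j _ => by rw [hk, hk]) (by rw [hk, Fintype.card_fin]; lia)
    have hxc : x ≠ c := fun h => hx (h ▸ hc)
    set S := insert x ((f i).erase c) with hS
    have hcS : c ∉ S := by grind
    have hSne : ∀ j, G.Adj i j → f j ≠ S := fun j hj he =>
      hcS (he ▸ hcT j ((G.mem_neighborFinset i j).2 hj))
    refine (hmin (Function.update f i S) ⟨fun j => ?_, fun u v huv => ?_⟩).not_gt ?_
    · rcases eq_or_ne j i with rfl | hj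
      · rw [Function.update_self, hS, Finset.card_insert_of_notMem (by grind),
          Finset.card_erase_add_one hc, hk]
      · rw [Function.update_of_ne hj, hk]
    · rcases eq_or_ne u i with rfl | hu
      · rw [Function.update_self, Function.update_of_ne huv.ne']
        exact (hSne v huv).symm
      · rcases eq_or_ne v i with rfl | hv
        · rw [Function.update_self, Function.update_of_ne hu]
          exact hSne u huv.symm
        · rw [Function.update_of_ne hu, Function.update_of_ne hv]
          exact hne u v huv
    · refine sum_sum_lt_sum_sum_of_row_lt (hsymm f) (hsymm _) i (by simp [F])
        (fun u v hu hv => by simp [F, hu, hv]) ?_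
      have hrow : ∀ g, ∑ v, F g i v = ∑ v ∈ G.neighborFinset i, (g i ∩ g v).card := fun g => by
        simp only [F, G.neighborFinset_eq_filter, Finset.sum_filter]
      rw [hrow, hrow]
      refine lt_of_eq_of_lt (Finset.sum_congr rfl fun v hv => ?_) hlt
      rw [Function.update_self, Function.update_of_ne ((G.mem_neighborFinset i v).1 hv).ne']
end

section
/- Let G = (N, E) be a finite simple graph in which every node has at least one neighbor, and let (OC_i)_{i ∈ N} be a family of finite color sets satisfying condition (i): OC_i \ OC_j ≠ ∅ for every ordered adjacent pair (i,j). Define the modified family OC'_i := ⋃_{j adjacent to i} (OC_i \ OC_j). Then every OC'_i is nonempty, the family (OC'_i) satisfies both condition (i) (OC'_i \ OC'_j ≠ ∅ for every ordered adjacent pair) and condition (ii) (⋃_{j adjacent to i} (OC'_i \ OC'_j) = OC'_i for every node i), and no extra colors are used: ⋃_{i ∈ N} OC'_i ⊆ ⋃_{i ∈ N} OC_i. -/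
/-- Let `G` be a finite simple graph in which every node has at least one
neighbor, and let `(OC i)` be a family of finite color sets satisfying condition (i):
`OC i \ OC j ≠ ∅` for every ordered adjacent pair `(i,j)`.  Define the modified family
`OC' i := ⋃_{j ~ i} (OC i \ OC j)`.  Then every `OC' i` is nonempty, the family `(OC' i)`
satisfies both condition (i) and condition (ii) (`⋃_{j ~ i} (OC' i \ OC' j) = OC' i` for
every node `i`), and no extra colors are used: `⋃ i, OC' i ⊆ ⋃ i, OC i`. -/
theorem modified_family_feasible
    {V : Type*} [Fintype V] [DecidableEq V]
    (G : SimpleGraph V) [DecidableRel G.Adj]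
    (hdeg : ∀ i : V, ∃ j : V, G.Adj i j)
    (OC : V → Finset ℕ)
    (h1 : ∀ i j : V, G.Adj i j → (OC i \ OC j).Nonempty)
    (OC' : V → Finset ℕ)
    (hOC' : ∀ i : V, OC' i = (G.neighborFinset i).biUnion (fun j => OC i \ OC j)) :
    (∀ i : V, (OC' i).Nonempty) ∧
    (∀ i j : V, G.Adj i j → (OC' i \ OC' j).Nonempty) ∧
    (∀ i : V, (G.neighborFinset i).biUnion (fun j => OC' i \ OC' j) = OC' i) ∧
    Finset.univ.biUnion OC' ⊆ Finset.univ.biUnion OC := by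
  have mem_iff (i : V) (c : ℕ) : c ∈ OC' i ↔ ∃ j, G.Adj i j ∧ c ∈ OC i ∧ c ∉ OC j := by
    simp [hOC']
  have subset (i : V) : OC' i ⊆ OC i := fun c hc => by
    obtain ⟨j, -, hi, -⟩ := (mem_iff i c).1 hc
    exact hi
  have sdiff_subset {i j : V} (hij : G.Adj i j) : OC i \ OC j ⊆ OC' i \ OC' j := fun c hc => by
    rw [Finset.mem_sdiff] at hc ⊢
    exact ⟨(mem_iff i c).2 ⟨j, hij, hc⟩, fun h => hc.2 (subset j h)⟩
  refine ⟨fun i => ?_, fun i j hij => (h1 i j hij).mono (sdiff_subset hij), fun i => ?_,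
    Finset.biUnion_mono fun i _ => subset i⟩
  · obtain ⟨j, hij⟩ := hdeg i
    exact (h1 i j hij).mono ((sdiff_subset hij).trans Finset.sdiff_subset)
  · apply Finset.Subset.antisymm
    · exact Finset.biUnion_subset.2 fun j _ => Finset.sdiff_subset
    · conv_lhs => rw [hOC' i]
      exact Finset.biUnion_mono fun j hj => sdiff_subset ((G.mem_neighborFinset i j).1 hj)
end
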